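/- In every execution of Algorithm A_k in which both processes decide, if r_1 = r_2 then r_1 = r_2 = k. -/

import Mathlib

/-!
Operational semantics of the two-process 1-bit-register approximate-agreement
protocol `A_k` (Algorithm 1 of the paper).

The two processes are indexed by `Fin 2`.  Shared memory consists of two 1-bit
registers `R 0, R 1` (initialized to `false`, i.e. `0`; only process `i` writes
`R i`) and two write-once input registers `I 0, I 1` (initialized to `⊥ = none`).
Each read or write of a single register is one atomic step.  An execution is
determined by the inputs `x : Fin 2 → Bool` together with a schedule
`sched : ℕ → Fin 2` telling which process takes the next step (a step of a
process that has already decided is a no-op; a process crashes by being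
scheduled only finitely often).
-/

namespace AlgoAk

/-- The other process. -/
def other (i : Fin 2) : Fin 2 := if i = 0 then 1 else 0

/-- The value (0 or 1) as a rational. -/
def bq (b : Bool) : ℚ := if b then 1 else 0

/-- Program counter of a process:
`start` = about to write its input to its input register;
`loopW` = about to perform the write of the current for-loop iteration;
`loopR` = about to perform the read of the current for-loop iteration;
`readMine` = left the for-loop, about to read its own input register;
`readOther` = about to read the other input register (and then decide);
`done` = has decided. -/
inductive PC where
  | start | loopW | loopR | readMine | readOther | done
deriving DecidableEq

/-- Local state of a process: program counter, loop variable `r`, local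
variables `prec` and `new`, the value read from the other input register,
and the output (once decided). -/
structure PState where
  pc : PC
  r : ℕ
  prec : Bool
  new : Bool
  xother : Option Bool
  out : Option ℚ

/-- Global configuration: local states, the two 1-bit registers, and the two
write-once input registers. -/
structure Config where
  p : Fin 2 → PState
  R : Fin 2 → Bool
  I : Fin 2 → Option Bool

/-- Initial local state. -/
def initP : PState := ⟨PC.start, 1, false, false, none, none⟩

/-- Initial configuration. -/
def initC : Config := ⟨fun _ => initP, fun _ => false, fun _ => none⟩

/-- Update the local state of process `i`. -/
def updP (c : Config) (i : Fin 2) (s : PState) : Config :=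
  { c with p := Function.update c.p i s }

/-- The decision function of the protocol, computed from the process' own input
`xme`, the value `xother` read from the other input register, and the values
`r` and `new` of the local variables when the for-loop was left. -/
def decideVal (k : ℕ) (xme : Bool) (xother : Option Bool) (r : ℕ) (new : Bool) : ℚ :=
  match xother with
  | none => bq xme
  | some xo =>
    if xme = xo then bq xme
    else if r = k ∧ new = decide (k % 2 = 1) then
      -- normal termination after k iterations
      let xwho := if r % 2 = 0 then xme else xo
      (bq xwho + (k : ℚ)) / (2 * (k : ℚ) + 1)
    else
      -- left the loop via a break at iteration r
      let xwho := if r % 2 = 0 then xo else xme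
      bq xwho + ((-1 : ℚ) ^ (if xwho then 1 else 0) * ((r : ℚ) - 1)) / (2 * (k : ℚ) + 1)

/-- One atomic step of process `i` in configuration `c`. -/
def step (k : ℕ) (x : Fin 2 → Bool) (c : Config) (i : Fin 2) : Config :=
  let s := c.p i
  match s.pc with
  | PC.start =>
      let c' := updP c i { s with pc := PC.loopW }
      { c' with I := Function.update c'.I i (some (x i)) }
  | PC.loopW =>
      let c' := updP c i { s with pc := PC.loopR }
      { c' with R := Function.update c'.R i (decide (s.r % 2 = 1)) }
  | PC.loopR =>
      let nv := c.R (other i)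
      if nv ≠ s.prec then
        if s.r < k then
          updP c i { s with pc := PC.loopW, r := s.r + 1, prec := nv, new := nv }
        else
          updP c i { s with pc := PC.readMine, prec := nv, new := nv }
      else
        updP c i { s with pc := PC.readMine, new := nv }
  | PC.readMine =>
      updP c i { s with pc := PC.readOther }
  | PC.readOther =>
      let xo := c.I (other i)
      updP c i { s with pc := PC.done, xother := xo,
                        out := some (decideVal k (x i) xo s.r s.new) }
  | PC.done => c

/-- The configuration after `n` steps of the execution of `A_k` with inputs `x`
and schedule `sched`. -/
def run (k : ℕ) (x : Fin 2 → Bool) (sched : ℕ → Fin 2) : ℕ → Config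
  | 0 => initC
  | n + 1 => step k x (run k x sched n) (sched n)

end AlgoAk

namespace AlgoAk

/-- The bit written in iteration `r` of the for-loop. -/
def bit (r : ℕ) : Bool := decide (r % 2 = 1)

/-- The process has left the for-loop. -/
def PC.exited (q : PC) : Prop := q = PC.readMine ∨ q = PC.readOther ∨ q = PC.done

/-- The relation between the local state of a process and its own register. -/
structure LocalInv (k : ℕ) (s : PState) (reg : Bool) : Prop where
  one_le : 1 ≤ s.r
  le : s.r ≤ k
  reg_before : s.pc = PC.start ∨ s.pc = PC.loopW → reg = bit (s.r - 1)
  reg_after : s.pc = PC.loopR ∨ s.pc.exited → reg = bit s.r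
  prec_eq : ¬ s.pc.exited → s.prec = bit (s.r - 1)

/-- The global invariant: two processes that left the loop in the same iteration did so in
iteration `k`. -/
structure Inv (k : ℕ) (c : Config) : Prop where
  loc : ∀ i, LocalInv k (c.p i) (c.R i)
  exit_eq : ∀ i, (c.p i).pc.exited → (c.p (other i)).pc.exited →
    (c.p i).r = (c.p (other i)).r → (c.p i).r = k

theorem other_ne (i : Fin 2) : other i ≠ i := by
  fin_cases i <;> simp [other]

theorem other_other (i : Fin 2) : other (other i) = i := by
  fin_cases i <;> simp [other]

theorem eq_or_eq_other (i j : Fin 2) : j = i ∨ j = other i := by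
  fin_cases i <;> fin_cases j <;> simp [other]

theorem bit_sub_one_ne {r : ℕ} (hr : 1 ≤ r) : bit r ≠ bit (r - 1) := by
  simp only [bit, ne_eq, decide_eq_decide]
  omega

theorem inv_initC {k : ℕ} (hk : 1 ≤ k) : Inv k initC := by
  constructor
  · intro i
    constructor <;> simp [initC, initP, bit, PC.exited, hk]
  · intro i h
    simp [initC, initP, PC.exited] at h

/-- A change of the local state and register of process `i` alone preserves the invariant. -/
theorem Inv.of_update {k : ℕ} {c c' : Config} (h : Inv k c) (i : Fin 2)
    (hp : c'.p (other i) = c.p (other i)) (hR : c'.R (other i) = c.R (other i))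
    (hloc : LocalInv k (c'.p i) (c'.R i))
    (hexit : (c'.p i).pc.exited → (c.p (other i)).pc.exited →
      (c'.p i).r = (c.p (other i)).r → (c'.p i).r = k) : Inv k c' := by
  constructor
  · intro j
    rcases eq_or_eq_other i j with rfl | rfl
    · exact hloc
    · rw [hp, hR]
      exact h.loc _
  · intro j
    rcases eq_or_eq_other i j with rfl | rfl
    · rw [hp]
      exact hexit
    · rw [hp, other_other]
      intro h₁ h₂ h₃
      rw [h₃]
      exact hexit h₂ h₁ h₃.symm

theorem Inv.step {k : ℕ} {c : Config} (h : Inv k c) (x : Fin 2 → Bool) (i : Fin 2) :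
    Inv k (step k x c i) := by
  have hi := h.loc i
  have ho := h.loc (other i)
  have hbit := bit_sub_one_ne hi.one_le
  have hne := other_ne i
  have hexit := h.exit_eq i
  obtain ⟨h1, h2, h3, h4, h5⟩ := hi
  have h6 := ho.reg_after
  cases hpc : (c.p i).pc <;> simp only [hpc, PC.exited] at h3 h4 h5 h6 hexit
  case loopR =>
    have hprec : (c.p i).prec = bit ((c.p i).r - 1) := by simpa using h5
    have hreg : c.R i = bit (c.p i).r := by simpa using h4
    by_cases hv : c.R (other i) = (c.p i).prec
    · apply h.of_update i <;> simp only [AlgoAk.step, hpc, updP, hv, ne_eq, not_true, if_false,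
        Function.update_self, Function.update_of_ne hne]
      · exact ⟨h1, h2, by simp, by simp [hreg], by simp [PC.exited]⟩
      · intro _ he hr
        exact absurd ((hr ▸ h6 (Or.inr he)).symm.trans (hv.trans hprec)) hbit
    · have hnew : c.R (other i) = bit (c.p i).r := by
        rw [hprec] at hv
        revert hv hbit
        cases c.R (other i) <;> cases bit (c.p i).r <;> cases bit ((c.p i).r - 1) <;> simp
      by_cases hk : (c.p i).r < k
      · apply h.of_update i <;> simp only [AlgoAk.step, hpc, updP, hv, hk, ne_eq, not_false_eq_true,
          if_true, Function.update_self, Function.update_of_ne hne]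
        · exact ⟨by simp, hk, by simp [hreg], by simp [PC.exited], by simp [hnew]⟩
        · simp [PC.exited]
      · apply h.of_update i <;> simp only [AlgoAk.step, hpc, updP, hv, hk, ne_eq, not_false_eq_true,
          if_true, if_false, Function.update_self, Function.update_of_ne hne]
        · exact ⟨h1, h2, by simp, by simp [hreg], by simp [PC.exited]⟩
        · intros
          omega
  case done => simpa [AlgoAk.step, hpc] using h
  all_goals
    apply h.of_update i <;> simp only [AlgoAk.step, hpc, updP,
        Function.update_self, Function.update_of_ne hne]
    · constructor <;> simp_all [PC.exited, bit]
    · simp_all [PC.exited]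

theorem inv_run {k : ℕ} (hk : 1 ≤ k) (x : Fin 2 → Bool) (sched : ℕ → Fin 2) (n : ℕ) :
    Inv k (run k x sched n) := by
  induction n with
  | zero => exact inv_initC hk
  | succ n ih => exact ih.step x (sched n)

theorem step_of_done {k : ℕ} {x : Fin 2 → Bool} {c : Config} {i : Fin 2}
    (h : (c.p i).pc = PC.done) (j : Fin 2) : (step k x c j).p i = c.p i := by
  by_cases hij : i = j
  · subst hij
    simp [step, h]
  · cases hpc : (c.p j).pc
    case loopR =>
      simp only [step, hpc, updP]
      split_ifs <;> simp only [Function.update_of_ne hij]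
    all_goals simp [step, hpc, updP, hij]

/-- A process that has decided keeps its local state. -/
theorem run_of_done {k : ℕ} {x : Fin 2 → Bool} {sched : ℕ → Fin 2} {i : Fin 2} {n m : ℕ}
    (h : ((run k x sched n).p i).pc = PC.done) (hnm : n ≤ m) :
    (run k x sched m).p i = (run k x sched n).p i := by
  induction m, hnm using Nat.le_induction with
  | base => rfl
  | succ m _ ih =>
    rw [run, step_of_done (by rw [ih]; exact h), ih]

end AlgoAk


open AlgoAk in
/-- Lemma 9: in every execution of `A_k` in which both processes decide, if the
numbers of for-loop iterations they performed are equal, then both equal `k`. -/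
theorem equal_iterations_imp_k (k : ℕ) (hk : 1 ≤ k) (x : Fin 2 → Bool)
    (sched : ℕ → Fin 2) (n₁ n₂ : ℕ)
    (h1 : ((run k x sched n₁).p 0).pc = PC.done)
    (h2 : ((run k x sched n₂).p 1).pc = PC.done)
    (heq : ((run k x sched n₁).p 0).r = ((run k x sched n₂).p 1).r) :
    ((run k x sched n₁).p 0).r = k ∧ ((run k x sched n₂).p 1).r = k := by
  have e1 := run_of_done h1 (le_max_left n₁ n₂)
  have e2 := run_of_done h2 (le_max_right n₁ n₂)
  have hexit := (inv_run hk x sched (max n₁ n₂)).exit_eq 0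
  simp only [other, if_true, e1, e2] at hexit
  have hr := hexit (Or.inr (Or.inr h1)) (Or.inr (Or.inr h2)) heq
  exact ⟨hr, heq ▸ hr⟩
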